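/- Let σ, τ ∈ 𝓘 be involutions such that σ ≤ τ in the Bruhat order and L(σ) ≥ L(τ). Then σ = τ. -/

import Mathlib

open scoped RealInnerProductSpace
open Classical

noncomputable section

variable (V : Type) [NormedAddCommGroup V] [InnerProductSpace ℝ V]

/-- The reflection determined by a vector `α` (the identity map if `α = 0`),
as a linear endomorphism:  `x ↦ x - (2⟪x,α⟫/⟪α,α⟫) • α`. -/
def reflMap (α : V) : V →ₗ[ℝ] V where
  toFun x := x - (2 * ⟪x, α⟫ / ⟪α, α⟫) • α
  map_add' x y := by
    simp only [inner_add_left]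
    rw [show 2 * (⟪x, α⟫ + ⟪y, α⟫) / ⟪α, α⟫
        = 2 * ⟪x, α⟫ / ⟪α, α⟫ + 2 * ⟪y, α⟫ / ⟪α, α⟫ by ring, add_smul]
    abel
  map_smul' c x := by
    simp only [real_inner_smul_left, RingHom.id_apply, smul_sub]
    rw [show 2 * (c * ⟪x, α⟫) / ⟪α, α⟫ = c * (2 * ⟪x, α⟫ / ⟪α, α⟫) by ring,
      mul_smul]

lemma reflMap_apply (α x : V) :
    reflMap V α x = x - (2 * ⟪x, α⟫ / ⟪α, α⟫) • α := rfl

lemma reflMap_involutive (α : V) : ∀ x, reflMap V α (reflMap V α x) = x := by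
  intro x
  by_cases h : (⟪α, α⟫ : ℝ) = 0
  · have h0 : α = 0 := inner_self_eq_zero.mp h
    simp [reflMap_apply, h0]
  · rw [reflMap_apply, reflMap_apply, inner_sub_left, real_inner_smul_left,
      div_mul_cancel₀ _ h]
    rw [show ⟪x, α⟫ - 2 * ⟪x, α⟫ = -⟪x, α⟫ by ring]
    rw [show 2 * -⟪x, α⟫ / ⟪α, α⟫ = -(2 * ⟪x, α⟫ / ⟪α, α⟫) by ring, neg_smul]
    abel

/-- The reflection determined by a vector `α`, as a linear automorphism of `V`. -/
def sref (α : V) : V ≃ₗ[ℝ] V :=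
  { reflMap V α with
    invFun := reflMap V α
    left_inv := reflMap_involutive V α
    right_inv := reflMap_involutive V α }

lemma sref_apply (α x : V) :
    sref V α x = x - (2 * ⟪x, α⟫ / ⟪α, α⟫) • α := rfl

variable {V}

/-- The coroot `α^∨ = 2α/⟪α,α⟫` associated with a root `α`, under the identification of the
coweight space with `V` given by the inner product. -/
def coroot (α : V) : V := (2 / ⟪α, α⟫) • α

/-- The dimension of the `(-1)`-eigenspace of a linear automorphism. -/
def lamEig (σ : V ≃ₗ[ℝ] V) : ℕ :=
  Module.finrank ℝ (Module.End.eigenspace (σ : V →ₗ[ℝ] V) (-1))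

/-- The action `s_α ∘ σ` of a simple reflection on an involution: `s_α σ` if `s_α` and `σ`
commute, and `s_α σ s_α` otherwise. -/
def circAct (α : V) (σ : V ≃ₗ[ℝ] V) : V ≃ₗ[ℝ] V :=
  if sref V α * σ = σ * sref V α then sref V α * σ else sref V α * σ * sref V α

/-- A set of pairwise orthogonal vectors. -/
def OrthSet (S : Finset V) : Prop :=
  (↑S : Set V).Pairwise fun a b => ⟪a, b⟫ = 0

/-- The product `σ_S` of the (commuting) reflections in the elements of an orthogonal set
`S`. -/
def sigmaOf (S : Finset V) : V ≃ₗ[ℝ] V :=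
  (S.toList.map (sref V)).prod

variable (V)

/-- A finite crystallographic reduced root system in the Euclidean space `V`,
together with a fixed choice of simple roots. -/
structure RSD where
  /-- The set of roots. -/
  Φ : Finset V
  /-- The set of simple roots. -/
  Δ : Finset V
  nonzero : (0 : V) ∉ Φ
  span_top : Submodule.span ℝ (Φ : Set V) = ⊤
  reduced : ∀ α ∈ Φ, ∀ c : ℝ, c • α ∈ Φ → c = 1 ∨ c = -1
  crystal : ∀ α ∈ Φ, ∀ β ∈ Φ, ∃ n : ℤ, (n : ℝ) = 2 * ⟪β, α⟫ / ⟪α, α⟫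
  reflClosed : ∀ α ∈ Φ, ∀ β ∈ Φ, sref V α β ∈ Φ
  Δ_sub : Δ ⊆ Φ
  Δ_indep : LinearIndependent ℝ (fun x : (Δ : Set V) => (x : V))
  Δ_base : ∀ α ∈ Φ, (∃ c : V → ℕ, α = ∑ γ ∈ Δ, (c γ : ℝ) • γ) ∨
      (∃ c : V → ℕ, -α = ∑ γ ∈ Δ, (c γ : ℝ) • γ)

namespace RSD

variable {V}
variable (D : RSD V)

/-- The set of positive roots. -/
def Pos : Set V :=
  {α | α ∈ D.Φ ∧ ∃ c : V → ℕ, α = ∑ γ ∈ D.Δ, (c γ : ℝ) • γ}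

/-- The set of negative roots. -/
def Neg : Set V := {α | -α ∈ D.Pos}

/-- The Weyl group, as the subgroup of `GL(V)` generated by the simple reflections. -/
def W : Subgroup (V ≃ₗ[ℝ] V) := Subgroup.closure ((fun γ => sref V γ) '' ↑D.Δ)

/-- The length of `w`: the least number of simple reflections needed to write `w` as a
product of simple reflections. -/
def length (w : V ≃ₗ[ℝ] V) : ℕ :=
  sInf {n | ∃ l : List V, l.length = n ∧ (∀ γ ∈ l, γ ∈ D.Δ) ∧ w = (l.map (sref V)).prod}

/-- The Bruhat order on the Weyl group: `u ≤ v` iff `v` is obtained from `u` by successively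
multiplying by reflections, each time increasing the length. -/
def ble (u v : V ≃ₗ[ℝ] V) : Prop :=
  Relation.ReflTransGen
    (fun x y => (∃ β ∈ D.Φ, y = sref V β * x) ∧ D.length x < D.length y) u v

/-- The strict Bruhat order. -/
def blt (u v : V ≃ₗ[ℝ] V) : Prop := D.ble u v ∧ u ≠ v

/-- The dominance order: `y - x` is a nonnegative integer combination of simple roots. -/
def dom (x y : V) : Prop := ∃ c : V → ℕ, y - x = ∑ γ ∈ D.Δ, (c γ : ℝ) • γ

/-- The dominance order on coweights: `y - x` is a nonnegative integer combination of simple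
coroots. -/
def cdom (x y : V) : Prop := ∃ c : V → ℕ, y - x = ∑ γ ∈ D.Δ, (c γ : ℝ) • coroot γ

/-- The length `L(σ) = (ℓ(σ) + λ(σ))/2` of an involution `σ`, where `λ(σ)` is the dimension
of the `(-1)`-eigenspace of `σ`. -/
def Linv (σ : V ≃ₗ[ℝ] V) : ℚ :=
  ((D.length σ : ℚ) + (lamEig σ : ℚ)) / 2

end RSD

/-- A finite irreducible crystallographic reduced root system, with a fixed choice of simple
roots and a marked simple root `αP` whose coefficient in the highest root `θ` equals `1`
(the cominuscule case). -/
structure MRSD extends RSD V where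
  irred : ¬ ∃ A B : Set V, A.Nonempty ∧ B.Nonempty ∧ A ∪ B = ↑Φ ∧
      ∀ α ∈ A, ∀ β ∈ B, ⟪α, β⟫ = 0
  /-- The marked simple root. -/
  αP : V
  αP_mem : αP ∈ Δ
  /-- The highest root. -/
  θ : V
  θ_mem : θ ∈ Φ
  θ_high : ∀ α ∈ Φ, ∃ c : V → ℕ, θ - α = ∑ γ ∈ Δ, (c γ : ℝ) • γ
  θ_coeff : ∃ c : V → ℕ, (θ = ∑ γ ∈ Δ, (c γ : ℝ) • γ) ∧ c αP = 1

namespace MRSD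

variable {V}
variable (M : MRSD V)

/-- The set `Ψ` of positive roots in which the marked simple root `αP` has coefficient `1`. -/
def Psi : Set V :=
  {α | α ∈ M.Φ ∧ ∃ c : V → ℕ, (α = ∑ γ ∈ M.Δ, (c γ : ℝ) • γ) ∧ c M.αP = 1}

/-- The set of positive roots of the subsystem `Φ_P`, i.e. the positive roots in which the
marked simple root `αP` has coefficient `0`. -/
def PosP : Set V :=
  {α | α ∈ M.Φ ∧ ∃ c : V → ℕ, (α = ∑ γ ∈ M.Δ, (c γ : ℝ) • γ) ∧ c M.αP = 0}

/-- The parabolic subgroup `W_P` generated by the simple reflections in `Δ ∖ {αP}`. -/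
def WP : Subgroup (V ≃ₗ[ℝ] V) :=
  Subgroup.closure ((fun γ => sref V γ) '' ↑(M.Δ.erase M.αP))

/-- The inversion set `Φ⁺(v) = {α ∈ Φ⁺ : v(α) ∈ Φ⁻}`. -/
def InvSet (v : V ≃ₗ[ℝ] V) : Set V := {α | α ∈ M.Pos ∧ v α ∈ M.Neg}

/-- `v` belongs to `W^P`: it lies in `W` and has minimal length in its coset `v W_P`. -/
def IsMinRep (v : V ≃ₗ[ℝ] V) : Prop :=
  v ∈ M.W ∧ ∀ u, u ∈ M.W → v⁻¹ * u ∈ M.WP → M.length v ≤ M.length u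

/-- `μ` is the minimal length representative `[w]^P` of the coset `w W_P`. -/
def IsMinRepOf (μ w : V ≃ₗ[ℝ] V) : Prop :=
  (μ ∈ M.W ∧ w⁻¹ * μ ∈ M.WP) ∧
    ∀ u, u ∈ M.W → w⁻¹ * u ∈ M.WP → M.length μ ≤ M.length u

/-- The subset `Φ_S = {α ∈ Φ : σ_S(α) = -α}` determined by an orthogonal set of roots `S`. -/
def PhiSet (S : Finset V) : Set V := {α | α ∈ M.Φ ∧ sigmaOf S α = -α}

/-- A root is long if its squared length is maximal among the roots. -/
def IsLong (α : V) : Prop := ∀ β ∈ M.Φ, ⟪β, β⟫ ≤ ⟪α, α⟫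

/-- Admissible pair: `v ∈ W^P`, `S ⊆ Ψ` a set of pairwise orthogonal roots with
`v(S) ⊆ Φ⁻`. -/
def Admissible (v : V ≃ₗ[ℝ] V) (S : Finset V) : Prop :=
  M.IsMinRep v ∧ (↑S : Set V) ⊆ M.Psi ∧ OrthSet S ∧ ∀ β ∈ S, v β ∈ M.Neg

/-- The length `L(v,S) = (ℓ(σ_{v(S)}) + |S|)/2` of an admissible pair `(v,S)`. -/
def pairL (v : V ≃ₗ[ℝ] V) (S : Finset V) : ℚ :=
  ((M.length (sigmaOf (S.image fun x => v x)) : ℚ) + (S.card : ℚ)) / 2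

end MRSD

lemma sref_mul_self {V : Type} [NormedAddCommGroup V] [InnerProductSpace ℝ V] (α : V) :
    sref V α * sref V α = 1 :=
  LinearEquiv.ext fun x => reflMap_involutive V α x

lemma sref_sref {V : Type} [NormedAddCommGroup V] [InnerProductSpace ℝ V] (α x : V) :
    sref V α (sref V α x) = x := reflMap_involutive V α x

lemma sref_inv {V : Type} [NormedAddCommGroup V] [InnerProductSpace ℝ V] (α : V) :
    (sref V α)⁻¹ = sref V α :=
  inv_eq_of_mul_eq_one_left (sref_mul_self α)

lemma sref_neg {V : Type} [NormedAddCommGroup V] [InnerProductSpace ℝ V] (α : V) :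
    sref V (-α) = sref V α := by
  ext x
  simp only [sref_apply, inner_neg_right, inner_neg_left, neg_neg, mul_neg, neg_div, smul_neg,
    neg_smul]

lemma sref_self {V : Type} [NormedAddCommGroup V] [InnerProductSpace ℝ V] {α : V} (h : α ≠ 0) :
    sref V α α = -α := by
  have h0 : (⟪α, α⟫ : ℝ) ≠ 0 := inner_self_ne_zero.mpr h
  rw [sref_apply, mul_div_assoc, div_self h0, mul_one, two_smul]
  abel

lemma inner_sref_sref {V : Type} [NormedAddCommGroup V] [InnerProductSpace ℝ V] (α x y : V) :
    ⟪sref V α x, sref V α y⟫ = ⟪x, y⟫ := by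
  by_cases h : (⟪α, α⟫ : ℝ) = 0
  · have h0 : α = 0 := inner_self_eq_zero.mp h
    simp [sref_apply, h0]
  · simp only [sref_apply, inner_sub_left, inner_sub_right, real_inner_smul_left,
      real_inner_smul_right, real_inner_comm y α]
    field_simp
    ring

/-- Conjugating a reflection by a linear isometry. -/
lemma mul_sref_of_isometry {V : Type} [NormedAddCommGroup V] [InnerProductSpace ℝ V]
    {w : V ≃ₗ[ℝ] V} (hw : ∀ x y, ⟪w x, w y⟫ = ⟪x, y⟫) (β : V) :
    w * sref V β = sref V (w β) * w := by
  ext x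
  simp only [LinearEquiv.mul_apply, sref_apply, map_sub, map_smul, hw]

lemma inv_apply_apply {V : Type} [NormedAddCommGroup V] [InnerProductSpace ℝ V]
    (w : V ≃ₗ[ℝ] V) (x : V) : w⁻¹ (w x) = x := w.symm_apply_apply x

lemma apply_inv_apply {V : Type} [NormedAddCommGroup V] [InnerProductSpace ℝ V]
    (w : V ≃ₗ[ℝ] V) (x : V) : w (w⁻¹ x) = x := w.apply_symm_apply x

/-- Conjugate linear automorphisms have `(-1)`-eigenspaces of the same dimension. -/
lemma lamEig_conj {V : Type} [NormedAddCommGroup V] [InnerProductSpace ℝ V]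
    (s σ : V ≃ₗ[ℝ] V) : lamEig (s * σ * s⁻¹) = lamEig σ := by
  have h : Module.End.eigenspace ((s * σ * s⁻¹ : V ≃ₗ[ℝ] V) : V →ₗ[ℝ] V) (-1)
      = (Module.End.eigenspace (σ : V →ₗ[ℝ] V) (-1)).map (s : V →ₗ[ℝ] V) := by
    ext x
    simp only [Module.End.mem_eigenspace_iff, Submodule.mem_map, LinearEquiv.coe_coe,
      LinearEquiv.mul_apply]
    constructor
    · intro hx
      refine ⟨s⁻¹ x, ?_, apply_inv_apply s x⟩
      apply s.injective
      rw [hx, map_smul, apply_inv_apply]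
    · rintro ⟨y, hy, rfl⟩
      rw [inv_apply_apply, hy, map_smul]
  unfold lamEig
  rw [h]
  exact LinearEquiv.finrank_map_eq s _

/-- Multiplying an involution `σ` by the reflection in a nonzero `(-1)`-eigenvector lowers the
dimension of the `(-1)`-eigenspace by one. -/
lemma lamEig_sref_mul {V : Type} [NormedAddCommGroup V] [InnerProductSpace ℝ V]
    [FiniteDimensional ℝ V] {σ : V ≃ₗ[ℝ] V} {α : V} (h0 : α ≠ 0) (hσ : σ * σ = 1)
    (hα : σ α = -α) : lamEig (sref V α * σ) + 1 = lamEig σ := by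
  have hi : (⟪α, α⟫ : ℝ) ≠ 0 := inner_self_ne_zero.mpr h0
  have hσ' : ∀ x, σ (σ x) = x := fun x => by
    rw [← LinearEquiv.mul_apply, hσ]; rfl
  have hle : Submodule.span ℝ {α} ≤ Module.End.eigenspace (σ : V →ₗ[ℝ] V) (-1) := by
    rw [Submodule.span_singleton_le_iff_mem, Module.End.mem_eigenspace_iff]
    simpa using hα
  have h : Module.End.eigenspace ((sref V α * σ : V ≃ₗ[ℝ] V) : V →ₗ[ℝ] V) (-1)
      = (Submodule.span ℝ {α})ᗮ ⊓ Module.End.eigenspace (σ : V →ₗ[ℝ] V) (-1) := by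
    ext x
    simp only [Module.End.mem_eigenspace_iff, Submodule.mem_inf, LinearEquiv.coe_coe,
      LinearEquiv.mul_apply, Submodule.mem_orthogonal_singleton_iff_inner_left, neg_smul, one_smul]
    constructor
    · intro hx
      have h1 : σ x = -sref V α x := by
        rw [← map_neg, ← hx, sref_sref]
      rw [sref_apply] at h1
      set c := 2 * ⟪x, α⟫ / ⟪α, α⟫ with hc
      have h2 := hσ' x
      rw [h1, map_neg, map_sub, map_smul, hα, h1] at h2
      have h3 : (2 * c) • α = 0 := by
        rw [two_mul, add_smul]
        have : x - (c • α + c • α) = x := by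
          rw [← sub_eq_zero] at h2 ⊢
          rw [← h2]; simp; abel
        simpa using this
      have h4 : c = 0 := by
        rcases smul_eq_zero.mp h3 with h | h
        · linarith
        · exact absurd h h0
      have h5 : (⟪x, α⟫ : ℝ) = 0 := by
        rw [hc] at h4
        rcases div_eq_zero_iff.mp h4 with h | h
        · linarith
        · exact absurd h hi
      refine ⟨h5, ?_⟩
      rw [h1, h4]; simp
    · rintro ⟨h1, h2⟩
      rw [h2, map_neg, sref_apply, h1]; simp
  unfold lamEig
  rw [h, ← Submodule.finrank_add_inf_finrank_orthogonal hle, finrank_span_singleton h0, add_comm]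

namespace RSD

variable {V : Type} [NormedAddCommGroup V] [InnerProductSpace ℝ V] (D : RSD V)

lemma ne_zero_of_mem {D : RSD V} {β : V} (hβ : β ∈ D.Φ) : β ≠ 0 := fun h => D.nonzero (h ▸ hβ)

lemma neg_mem {D : RSD V} {β : V} (hβ : β ∈ D.Φ) : -β ∈ D.Φ := by
  have := D.reflClosed β hβ β hβ
  rwa [sref_self (ne_zero_of_mem hβ)] at this

lemma span_Δ : Submodule.span ℝ (D.Δ : Set V) = ⊤ := by
  rw [eq_top_iff, ← D.span_top, Submodule.span_le]
  have key : ∀ c : V → ℕ, ∑ γ ∈ D.Δ, (c γ : ℝ) • γ ∈ Submodule.span ℝ (D.Δ : Set V) :=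
    fun c => Submodule.sum_mem _ fun γ hγ =>
      Submodule.smul_mem _ _ (Submodule.subset_span hγ)
  intro α hα
  rcases D.Δ_base α hα with ⟨c, hc⟩ | ⟨c, hc⟩
  · rw [hc]; exact key c
  · rw [SetLike.mem_coe, ← neg_mem_iff, hc]; exact key c

/-- The basis of `V` given by the simple roots. -/
def simpleBasis : Module.Basis (D.Δ : Set V) ℝ V :=
  Module.Basis.mk D.Δ_indep (by rw [Subtype.range_coe]; exact D.span_Δ.ge)

/-- The linear functional with prescribed values on the simple roots. -/
def functional (g : V → ℝ) : V →ₗ[ℝ] ℝ := D.simpleBasis.constr ℝ fun γ => g γ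

lemma functional_apply (g : V → ℝ) {γ : V} (hγ : γ ∈ D.Δ) : D.functional g γ = g γ := by
  have h := D.simpleBasis.constr_basis ℝ (fun γ : (D.Δ : Set V) => g γ) ⟨γ, hγ⟩
  rwa [simpleBasis, Module.Basis.mk_apply] at h

lemma functional_sum (g : V → ℝ) (c : V → ℕ) :
    D.functional g (∑ γ ∈ D.Δ, (c γ : ℝ) • γ) = ∑ γ ∈ D.Δ, (c γ : ℝ) * g γ := by
  rw [map_sum]
  exact Finset.sum_congr rfl fun γ hγ => by rw [map_smul, D.functional_apply g hγ, smul_eq_mul]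

/-- The height functional, with value `1` on every simple root. -/
def ht : V →ₗ[ℝ] ℝ := D.functional fun _ => 1

lemma ht_simple {γ : V} (hγ : γ ∈ D.Δ) : D.ht γ = 1 := D.functional_apply _ hγ

lemma ht_pos_of_eq_sum {α : V} (h0 : α ≠ 0) {c : V → ℕ} (hc : α = ∑ γ ∈ D.Δ, (c γ : ℝ) • γ) :
    0 < D.ht α := by
  rw [ht, hc, functional_sum]
  simp only [mul_one]
  have hnn : ∀ γ ∈ D.Δ, (0 : ℝ) ≤ c γ := fun γ _ => Nat.cast_nonneg _
  refine lt_of_le_of_ne (Finset.sum_nonneg hnn) fun h => h0 ?_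
  have h' := (Finset.sum_eq_zero_iff_of_nonneg hnn).mp h.symm
  rw [hc]
  exact Finset.sum_eq_zero fun γ hγ => by rw [h' γ hγ, zero_smul]

lemma exists_sum_of_ht_pos {α : V} (hα : α ∈ D.Φ) (h : 0 < D.ht α) :
    ∃ c : V → ℕ, α = ∑ γ ∈ D.Δ, (c γ : ℝ) • γ := by
  rcases D.Δ_base α hα with hc | ⟨c, hc⟩
  · exact hc
  · have := D.ht_pos_of_eq_sum (neg_ne_zero.mpr (ne_zero_of_mem hα)) hc
    rw [map_neg] at this
    linarith

lemma ht_ne_zero {α : V} (hα : α ∈ D.Φ) : D.ht α ≠ 0 := by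
  have h0 := ne_zero_of_mem hα
  rcases D.Δ_base α hα with ⟨c, hc⟩ | ⟨c, hc⟩
  · exact (D.ht_pos_of_eq_sum h0 hc).ne'
  · have := D.ht_pos_of_eq_sum (neg_ne_zero.mpr h0) hc
    rw [map_neg] at this
    intro h
    linarith

/-- A simple reflection permutes the positive roots other than its own. -/
lemma ht_sref_pos {α β : V} (hα : α ∈ D.Δ) (hβ : β ∈ D.Φ) (hpos : 0 < D.ht β) (hne : β ≠ α) :
    0 < D.ht (sref V α β) := by
  have hs := D.reflClosed α (D.Δ_sub hα) β hβ
  by_contra hcon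
  have hneg : 0 < D.ht (-sref V α β) := by
    rw [map_neg]
    have := D.ht_ne_zero hs
    rcases lt_or_gt_of_ne this with h | h
    · linarith
    · exact absurd h hcon
  obtain ⟨c, hc⟩ := D.exists_sum_of_ht_pos hβ hpos
  obtain ⟨d, hd⟩ := D.exists_sum_of_ht_pos (neg_mem hs) hneg
  have hzero : ∀ γ ∈ D.Δ, γ ≠ α → c γ = 0 := by
    intro γ hγ hγα
    have ev : ∀ e : V → ℕ,
        D.functional (fun x => if x = γ then 1 else 0) (∑ γ ∈ D.Δ, (e γ : ℝ) • γ) = e γ := by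
      intro e
      rw [functional_sum]
      simp [hγ]
    have h1 := ev c
    have h2 := ev d
    rw [← hc] at h1
    rw [← hd, map_neg, sref_apply, map_sub, map_smul, D.functional_apply _ hα,
      if_neg (Ne.symm hγα), h1] at h2
    simp only [smul_zero, sub_zero] at h2
    have h3 : (0 : ℝ) ≤ c γ := Nat.cast_nonneg _
    have h4 : (0 : ℝ) ≤ d γ := Nat.cast_nonneg _
    have h5 : (c γ : ℝ) = 0 := by linarith
    exact_mod_cast h5
  have hβα : β = (c α : ℝ) • α := by
    rw [hc]
    exact Finset.sum_eq_single_of_mem α hα fun γ hγ h => by simp [hzero γ hγ h]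
  rcases D.reduced α (D.Δ_sub hα) (c α) (hβα ▸ hβ) with h | h
  · exact hne (by rw [hβα, h, one_smul])
  · have : (0 : ℝ) ≤ c α := Nat.cast_nonneg _
    linarith

lemma sref_simple_mem_W {γ : V} (hγ : γ ∈ D.Δ) : sref V γ ∈ D.W :=
  Subgroup.subset_closure ⟨γ, hγ, rfl⟩

lemma inner_apply_apply {w : V ≃ₗ[ℝ] V} (hw : w ∈ D.W) : ∀ x y, ⟪w x, w y⟫ = ⟪x, y⟫ := by
  induction hw using Subgroup.closure_induction with
  | mem w hw =>
    obtain ⟨γ, -, rfl⟩ := hw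
    exact inner_sref_sref γ
  | one => intro x y; rfl
  | mul u v _ _ hu hv => intro x y; rw [LinearEquiv.mul_apply, LinearEquiv.mul_apply, hu, hv]
  | inv u _ hu => intro x y; rw [← hu, apply_inv_apply, apply_inv_apply]

/-- Every element of the Weyl group is a product of simple reflections. -/
lemma exists_word {w : V ≃ₗ[ℝ] V} (hw : w ∈ D.W) :
    ∃ l : List V, (∀ γ ∈ l, γ ∈ D.Δ) ∧ w = (l.map (sref V)).prod := by
  induction hw using Subgroup.closure_induction with
  | mem w hw =>
    obtain ⟨γ, hγ, rfl⟩ := hw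
    exact ⟨[γ], by simpa using hγ, by simp⟩
  | one => exact ⟨[], by simp, by simp⟩
  | mul u v _ _ hu hv =>
    obtain ⟨l, hl, rfl⟩ := hu
    obtain ⟨m, hm, rfl⟩ := hv
    refine ⟨l ++ m, fun γ hγ => ?_, by simp⟩
    rcases List.mem_append.mp hγ with h | h
    · exact hl γ h
    · exact hm γ h
  | inv u _ hu =>
    obtain ⟨l, hl, rfl⟩ := hu
    refine ⟨l.reverse, fun γ hγ => hl γ (List.mem_reverse.mp hγ), ?_⟩
    rw [List.prod_inv_reverse, List.map_map, List.map_reverse]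
    congr 3

lemma apply_mem {w : V ≃ₗ[ℝ] V} (hw : w ∈ D.W) {β : V} (hβ : β ∈ D.Φ) : w β ∈ D.Φ := by
  obtain ⟨l, hl, rfl⟩ := D.exists_word hw
  clear hw
  induction l with
  | nil => simpa using hβ
  | cons γ l ih =>
    simp only [List.map_cons, List.prod_cons, LinearEquiv.mul_apply]
    exact D.reflClosed γ (D.Δ_sub (hl γ (by simp))) _ (ih fun δ hδ => hl δ (by simp [hδ]))

lemma sref_mem_W_of_ht_pos {β : V} (hβ : β ∈ D.Φ) (hpos : 0 < D.ht β) : sref V β ∈ D.W := by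
  by_contra hcon
  obtain ⟨δ, hδ, hmin⟩ := (D.Φ.filter fun δ => 0 < D.ht δ ∧ sref V δ ∉ D.W).exists_min_image D.ht
    ⟨β, by simp [hβ, hpos, hcon]⟩
  simp only [Finset.mem_filter] at hδ hmin
  obtain ⟨hδ, hδpos, hδW⟩ := hδ
  obtain ⟨c, hc⟩ := D.exists_sum_of_ht_pos hδ hδpos
  obtain ⟨γ, hγ, hγδ⟩ : ∃ γ ∈ D.Δ, 0 < (⟪δ, γ⟫ : ℝ) := by
    by_contra! h
    have h1 : (0 : ℝ) < ⟪δ, δ⟫ := real_inner_self_pos.mpr (ne_zero_of_mem hδ)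
    have h2 : (⟪δ, δ⟫ : ℝ) = ∑ γ ∈ D.Δ, (c γ : ℝ) * ⟪δ, γ⟫ := by
      conv_lhs => rw [congrArg (inner ℝ δ) hc, inner_sum]
      simp only [real_inner_smul_right]
    have h3 : ∑ γ ∈ D.Δ, (c γ : ℝ) * ⟪δ, γ⟫ ≤ 0 := Finset.sum_nonpos fun γ hγ =>
      mul_nonpos_of_nonneg_of_nonpos (Nat.cast_nonneg _) (h γ hγ)
    linarith
  have hne : δ ≠ γ := fun h => hδW (h ▸ D.sref_simple_mem_W hγ)
  have hsW := D.sref_simple_mem_W hγ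
  have hnot : sref V (sref V γ δ) ∉ D.W := by
    intro h
    apply hδW
    have hconj := mul_sref_of_isometry (inner_sref_sref γ) δ
    have : sref V δ = sref V γ * (sref V (sref V γ δ) * sref V γ) := by
      rw [← hconj, ← mul_assoc, sref_mul_self, one_mul]
    rw [this]
    exact D.W.mul_mem hsW (D.W.mul_mem h hsW)
  have hlt := hmin _ ⟨D.reflClosed γ (D.Δ_sub hγ) δ hδ, D.ht_sref_pos hγ hδ hδpos hne, hnot⟩
  rw [sref_apply, map_sub, map_smul, D.ht_simple hγ, smul_eq_mul, mul_one] at hlt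
  have hγγ : (0 : ℝ) < ⟪γ, γ⟫ := real_inner_self_pos.mpr (ne_zero_of_mem (D.Δ_sub hγ))
  have : 0 < 2 * ⟪δ, γ⟫ / ⟪γ, γ⟫ := by positivity
  linarith

lemma exists_pos_root {β : V} (hβ : β ∈ D.Φ) :
    ∃ δ ∈ D.Φ, 0 < D.ht δ ∧ sref V δ = sref V β := by
  rcases lt_or_gt_of_ne (D.ht_ne_zero hβ) with h | h
  · exact ⟨-β, neg_mem hβ, by rw [map_neg]; linarith, sref_neg β⟩
  · exact ⟨β, hβ, h, rfl⟩

/-- All reflections in roots belong to the Weyl group. -/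
lemma sref_mem_W {β : V} (hβ : β ∈ D.Φ) : sref V β ∈ D.W := by
  obtain ⟨δ, hδ, hpos, h⟩ := D.exists_pos_root hβ
  exact h ▸ D.sref_mem_W_of_ht_pos hδ hpos

lemma length_le {l : List V} (hl : ∀ γ ∈ l, γ ∈ D.Δ) :
    D.length (l.map (sref V)).prod ≤ l.length :=
  Nat.sInf_le ⟨l, rfl, hl, rfl⟩

lemma exists_reduced_word {w : V ≃ₗ[ℝ] V} (hw : w ∈ D.W) :
    ∃ l : List V, l.length = D.length w ∧ (∀ γ ∈ l, γ ∈ D.Δ) ∧ w = (l.map (sref V)).prod := by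
  obtain ⟨l, hl, hlw⟩ := D.exists_word hw
  exact Nat.sInf_mem (s := {n | ∃ l : List V, l.length = n ∧ (∀ γ ∈ l, γ ∈ D.Δ) ∧
    w = (l.map (sref V)).prod}) ⟨l.length, l, rfl, hl, hlw⟩

lemma length_simple_mul_le {w : V ≃ₗ[ℝ] V} (hw : w ∈ D.W) {α : V} (hα : α ∈ D.Δ) :
    D.length (sref V α * w) ≤ D.length w + 1 := by
  obtain ⟨l, hlen, hl, rfl⟩ := D.exists_reduced_word hw
  have := D.length_le (l := α :: l) (by
    intro γ hγ
    rcases List.mem_cons.mp hγ with h | h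
    · exact h ▸ hα
    · exact hl γ h)
  rw [List.length_cons, hlen] at this
  simpa using this

lemma length_mul_simple_le {w : V ≃ₗ[ℝ] V} (hw : w ∈ D.W) {α : V} (hα : α ∈ D.Δ) :
    D.length (w * sref V α) ≤ D.length w + 1 := by
  obtain ⟨l, hlen, hl, rfl⟩ := D.exists_reduced_word hw
  have := D.length_le (l := l ++ [α]) (by
    intro γ hγ
    rcases List.mem_append.mp hγ with h | h
    · exact hl γ h
    · exact List.mem_singleton.mp h ▸ hα)
  rw [List.length_append, hlen] at this
  simpa using this

lemma exists_shorter_word (l : List V) (hl : ∀ γ ∈ l, γ ∈ D.Δ) {β : V} (hβ : β ∈ D.Φ)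
    (hpos : 0 < D.ht β) (hneg : D.ht ((l.map (sref V)).prod⁻¹ β) < 0) :
    ∃ m : List V, m.length < l.length ∧ (∀ γ ∈ m, γ ∈ D.Δ) ∧
      sref V β * (l.map (sref V)).prod = (m.map (sref V)).prod := by
  induction l generalizing β with
  | nil =>
    simp only [List.map_nil, List.prod_nil, inv_one, LinearEquiv.coe_one, id] at hneg
    linarith
  | cons γ l ih =>
    have hγ : γ ∈ D.Δ := hl γ (by simp)
    have hl' : ∀ δ ∈ l, δ ∈ D.Δ := fun δ hδ => hl δ (by simp [hδ])
    by_cases h : β = γ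
    · refine ⟨l, by simp, hl', ?_⟩
      rw [h, List.map_cons, List.prod_cons, ← mul_assoc, sref_mul_self, one_mul]
    · rw [List.map_cons, List.prod_cons, mul_inv_rev, sref_inv, LinearEquiv.mul_apply] at hneg
      obtain ⟨m, hm, hmΔ, hprod⟩ := ih hl' (D.reflClosed γ (D.Δ_sub hγ) β hβ)
        (D.ht_sref_pos hγ hβ hpos h) hneg
      refine ⟨γ :: m, by simpa using hm, ?_, ?_⟩
      · intro δ hδ
        rcases List.mem_cons.mp hδ with h | h
        · exact h ▸ hγ
        · exact hmΔ δ h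
      · have hconj := mul_sref_of_isometry (inner_sref_sref γ) (sref V γ β)
        rw [sref_sref] at hconj
        rw [List.map_cons, List.prod_cons, List.map_cons, List.prod_cons, ← hprod, ← mul_assoc,
          ← mul_assoc, hconj]

lemma length_sref_mul_lt {x : V ≃ₗ[ℝ] V} (hx : x ∈ D.W) {β : V} (hβ : β ∈ D.Φ)
    (hpos : 0 < D.ht β) (hneg : D.ht (x⁻¹ β) < 0) :
    D.length (sref V β * x) < D.length x := by
  obtain ⟨l, hlen, hl, rfl⟩ := D.exists_reduced_word hx
  obtain ⟨m, hm, hmΔ, hprod⟩ := D.exists_shorter_word l hl hβ hpos hneg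
  rw [hprod, ← hlen]
  exact (D.length_le hmΔ).trans_lt hm

lemma length_lt_sref_mul {x : V ≃ₗ[ℝ] V} (hx : x ∈ D.W) {β : V} (hβ : β ∈ D.Φ)
    (hpos : 0 < D.ht β) (hpos' : 0 < D.ht (x⁻¹ β)) :
    D.length x < D.length (sref V β * x) := by
  have h := D.length_sref_mul_lt (D.W.mul_mem (D.sref_mem_W hβ) hx) hβ hpos (by
    rw [mul_inv_rev, sref_inv, LinearEquiv.mul_apply, sref_self (ne_zero_of_mem hβ), map_neg,
      map_neg]
    linarith)
  rwa [← mul_assoc, sref_mul_self, one_mul] at h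

lemma length_lt_sref_mul_iff {x : V ≃ₗ[ℝ] V} (hx : x ∈ D.W) {β : V} (hβ : β ∈ D.Φ)
    (hpos : 0 < D.ht β) : D.length x < D.length (sref V β * x) ↔ 0 < D.ht (x⁻¹ β) := by
  refine ⟨fun h => ?_, D.length_lt_sref_mul hx hβ hpos⟩
  rcases lt_or_gt_of_ne (D.ht_ne_zero (D.apply_mem (D.W.inv_mem hx) hβ)) with h' | h'
  · have := D.length_sref_mul_lt hx hβ hpos h'
    omega
  · exact h'

lemma length_sref_mul_ne {x : V ≃ₗ[ℝ] V} (hx : x ∈ D.W) {β : V} (hβ : β ∈ D.Φ) :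
    D.length (sref V β * x) ≠ D.length x := by
  obtain ⟨δ, hδ, hpos, h⟩ := D.exists_pos_root hβ
  rw [← h]
  rcases lt_or_gt_of_ne (D.ht_ne_zero (D.apply_mem (D.W.inv_mem hx) hδ)) with h' | h'
  · exact (D.length_sref_mul_lt hx hδ hpos h').ne
  · exact (D.length_lt_sref_mul hx hδ hpos h').ne'

lemma mul_sref {x : V ≃ₗ[ℝ] V} (hx : x ∈ D.W) (β : V) : x * sref V β = sref V (x β) * x :=
  mul_sref_of_isometry (D.inner_apply_apply hx) β

lemma length_simple_mul_lt_iff {x : V ≃ₗ[ℝ] V} (hx : x ∈ D.W) {α : V} (hα : α ∈ D.Δ) :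
    D.length (sref V α * x) < D.length x ↔ D.ht (x⁻¹ α) < 0 := by
  have hpos : 0 < D.ht α := by rw [D.ht_simple hα]; exact one_pos
  have h1 := D.length_lt_sref_mul_iff hx (D.Δ_sub hα) hpos
  have h2 := D.length_sref_mul_ne hx (D.Δ_sub hα)
  have h3 := D.ht_ne_zero (D.apply_mem (D.W.inv_mem hx) (D.Δ_sub hα))
  rw [← not_iff_not, not_lt, not_lt, h2.symm.le_iff_lt, h1, h3.symm.le_iff_lt]

lemma length_mul_simple_lt_iff {x : V ≃ₗ[ℝ] V} (hx : x ∈ D.W) {α : V} (hα : α ∈ D.Δ) :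
    D.length (x * sref V α) < D.length x ↔ D.ht (x α) < 0 := by
  have hpos : 0 < D.ht α := by rw [D.ht_simple hα]; exact one_pos
  have hxα := D.apply_mem hx (D.Δ_sub hα)
  rw [D.mul_sref hx]
  rcases lt_or_gt_of_ne (D.ht_ne_zero hxα) with h | h
  · refine ⟨fun _ => h, fun _ => ?_⟩
    rw [← sref_neg]
    apply D.length_sref_mul_lt hx (neg_mem hxα)
    · rw [map_neg]; linarith
    · rw [map_neg, inv_apply_apply, map_neg]; linarith
  · have := D.length_lt_sref_mul hx hxα h (by rwa [inv_apply_apply])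
    constructor <;> intro <;> linarith

/-- The covering-type relation generating the Bruhat order. -/
def bedge (x y : V ≃ₗ[ℝ] V) : Prop :=
  (∃ β ∈ D.Φ, y = sref V β * x) ∧ D.length x < D.length y

lemma bedge_mem_W {x y : V ≃ₗ[ℝ] V} (hx : x ∈ D.W) (h : D.bedge x y) : y ∈ D.W := by
  obtain ⟨⟨β, hβ, rfl⟩, -⟩ := h
  exact D.W.mul_mem (D.sref_mem_W hβ) hx

lemma ble_length {x y : V ≃ₗ[ℝ] V} (h : D.ble x y) : D.length x ≤ D.length y := by
  induction h with
  | refl => exact le_rfl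
  | tail _ h ih => exact ih.trans h.2.le

lemma ble_of_bedge {x y : V ≃ₗ[ℝ] V} (h : D.bedge x y) : D.ble x y := Relation.ReflTransGen.single h

lemma bedge_left {x y : V ≃ₗ[ℝ] V} (hx : x ∈ D.W) (h : D.bedge x y) {α : V} (hα : α ∈ D.Δ) :
    y = sref V α * x ∨ D.bedge (sref V α * x) (sref V α * y) := by
  obtain ⟨⟨β, hβ, rfl⟩, hlt⟩ := h
  obtain ⟨δ, hδ, hpos, h⟩ := D.exists_pos_root hβ
  rw [← h] at hlt ⊢
  by_cases hne : δ = α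
  · left; rw [hne]
  · right
    have hs := D.sref_simple_mem_W hα
    have heq : sref V α * (sref V δ * x) = sref V (sref V α δ) * (sref V α * x) := by
      rw [← mul_assoc, D.mul_sref hs, mul_assoc]
    have hδ' := D.reflClosed α (D.Δ_sub hα) δ hδ
    refine ⟨⟨_, hδ', heq⟩, ?_⟩
    rw [heq]
    apply D.length_lt_sref_mul (D.W.mul_mem hs hx) hδ' (D.ht_sref_pos hα hδ hpos hne)
    rw [mul_inv_rev, sref_inv, LinearEquiv.mul_apply, sref_sref]
    exact (D.length_lt_sref_mul_iff hx hδ hpos).mp hlt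

lemma bedge_right {x y : V ≃ₗ[ℝ] V} (hx : x ∈ D.W) (h : D.bedge x y) {α : V} (hα : α ∈ D.Δ) :
    y = x * sref V α ∨ D.bedge (x * sref V α) (y * sref V α) := by
  obtain ⟨⟨β, hβ, rfl⟩, hlt⟩ := h
  obtain ⟨δ, hδ, hpos, h⟩ := D.exists_pos_root hβ
  rw [← h] at hlt ⊢
  have hx_pos := (D.length_lt_sref_mul_iff hx hδ hpos).mp hlt
  by_cases hne : x⁻¹ δ = α
  · left; rw [D.mul_sref hx, ← hne, apply_inv_apply]
  · right
    refine ⟨⟨δ, hδ, mul_assoc _ _ _⟩, ?_⟩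
    rw [mul_assoc]
    apply D.length_lt_sref_mul (D.W.mul_mem hx (D.sref_simple_mem_W hα)) hδ hpos
    rw [mul_inv_rev, sref_inv, LinearEquiv.mul_apply]
    exact D.ht_sref_pos hα (D.apply_mem (D.W.inv_mem hx) hδ) hx_pos hne

/-- The shorter one of `x` and `f x`. -/
def shorter (f : (V ≃ₗ[ℝ] V) → (V ≃ₗ[ℝ] V)) (x : V ≃ₗ[ℝ] V) : V ≃ₗ[ℝ] V :=
  if D.length (f x) < D.length x then f x else x

/-- The common form of the left and right lifting properties of the Bruhat order. -/
lemma shorter_mono {f : (V ≃ₗ[ℝ] V) → (V ≃ₗ[ℝ] V)} (hff : ∀ x, f (f x) = x)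
    (hf : ∀ x ∈ D.W, ∃ β ∈ D.Φ, f x = sref V β * x)
    (hedge : ∀ x ∈ D.W, ∀ y, D.bedge x y → y = f x ∨ D.bedge (f x) (f y))
    {u v : V ≃ₗ[ℝ] V} (hu : u ∈ D.W) (h : D.ble u v) :
    v ∈ D.W ∧ D.ble (D.shorter f u) (D.shorter f v) := by
  have hne : ∀ x ∈ D.W, D.length (f x) ≠ D.length x := by
    intro x hx
    obtain ⟨β, hβ, h⟩ := hf x hx
    rw [h]
    exact D.length_sref_mul_ne hx hβ
  have hle : ∀ x ∈ D.W, D.ble (D.shorter f x) x ∧ D.ble (D.shorter f x) (f x) := by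
    intro x hx
    obtain ⟨β, hβ, h⟩ := hf x hx
    unfold shorter
    split_ifs with hlt
    · refine ⟨D.ble_of_bedge ⟨⟨β, hβ, ?_⟩, hlt⟩, Relation.ReflTransGen.refl⟩
      rw [h, ← mul_assoc, sref_mul_self, one_mul]
    · exact ⟨Relation.ReflTransGen.refl, D.ble_of_bedge
        ⟨⟨β, hβ, h⟩, lt_of_le_of_ne (not_lt.mp hlt) (hne x hx).symm⟩⟩
  induction h with
  | refl => exact ⟨hu, Relation.ReflTransGen.refl⟩
  | @tail x y _ hxy ih =>
    obtain ⟨hx, ih⟩ := ih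
    refine ⟨D.bedge_mem_W hx hxy, Relation.ReflTransGen.trans ih ?_⟩
    rcases hedge x hx y hxy with rfl | hfe
    · have h1 := hne x hx
      have h2 : D.shorter f (f x) = D.shorter f x := by
        unfold shorter
        rw [hff]
        split_ifs <;> first | rfl | omega
      rw [h2]
    · by_cases hlt : D.length (f y) < D.length y
      · rw [show D.shorter f y = f y from if_pos hlt]
        exact (hle x hx).2.trans (D.ble_of_bedge hfe)
      · rw [show D.shorter f y = y from if_neg hlt]
        exact (hle x hx).1.trans (D.ble_of_bedge hxy)

/-- The result of shortening `x` by `s_α` first on the left and then on the right. -/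
def descend (α : V) (x : V ≃ₗ[ℝ] V) : V ≃ₗ[ℝ] V :=
  D.shorter (fun y => y * sref V α) (D.shorter (fun y => sref V α * y) x)

lemma shorter_left_mem_W {α : V} (hα : α ∈ D.Δ) {x : V ≃ₗ[ℝ] V} (hx : x ∈ D.W) :
    D.shorter (fun y => sref V α * y) x ∈ D.W := by
  unfold shorter
  split_ifs
  · exact D.W.mul_mem (D.sref_simple_mem_W hα) hx
  · exact hx

lemma descend_mono {α : V} (hα : α ∈ D.Δ) {u v : V ≃ₗ[ℝ] V} (hu : u ∈ D.W) (h : D.ble u v) :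
    D.ble (D.descend α u) (D.descend α v) := by
  have hleft := D.shorter_mono (f := fun y => sref V α * y)
    (fun x => by rw [← mul_assoc, sref_mul_self, one_mul])
    (fun x _ => ⟨α, D.Δ_sub hα, rfl⟩) (fun x hx y hxy => D.bedge_left hx hxy hα) hu h
  exact (D.shorter_mono (f := fun y => y * sref V α)
    (fun x => by rw [mul_assoc, sref_mul_self, mul_one])
    (fun x hx => ⟨x α, D.apply_mem hx (D.Δ_sub hα), D.mul_sref hx α⟩)
    (fun x hx y hxy => D.bedge_right hx hxy hα) (D.shorter_left_mem_W hα hu) hleft.2).2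

lemma inv_eq_self_of_mul_self {σ : V ≃ₗ[ℝ] V} (hσ : σ * σ = 1) : σ⁻¹ = σ :=
  inv_eq_of_mul_eq_one_left hσ

lemma descend_of_ht_pos {α : V} (hα : α ∈ D.Δ) {σ : V ≃ₗ[ℝ] V} (hσW : σ ∈ D.W)
    (hσ : σ * σ = 1) (h : 0 < D.ht (σ α)) : D.descend α σ = σ := by
  have h1 : ¬ D.length (sref V α * σ) < D.length σ := by
    rw [D.length_simple_mul_lt_iff hσW hα, inv_eq_self_of_mul_self hσ]; linarith
  have h2 : ¬ D.length (σ * sref V α) < D.length σ := by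
    rw [D.length_mul_simple_lt_iff hσW hα]; linarith
  simp only [descend, shorter, if_neg h1, if_neg h2]

lemma shorter_left_of_ht_neg {α : V} (hα : α ∈ D.Δ) {σ : V ≃ₗ[ℝ] V} (hσW : σ ∈ D.W)
    (hσ : σ * σ = 1) (h : D.ht (σ α) < 0) :
    D.shorter (fun y => sref V α * y) σ = sref V α * σ := by
  apply if_pos
  rw [D.length_simple_mul_lt_iff hσW hα, inv_eq_self_of_mul_self hσ]
  exact h

lemma descend_of_apply_eq_neg {α : V} (hα : α ∈ D.Δ) {σ : V ≃ₗ[ℝ] V} (hσW : σ ∈ D.W)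
    (hσ : σ * σ = 1) (h : σ α = -α) : D.descend α σ = sref V α * σ := by
  have hpos : D.ht α = 1 := D.ht_simple hα
  have hs := D.sref_simple_mem_W hα
  rw [descend, D.shorter_left_of_ht_neg hα hσW hσ (by rw [h, map_neg]; linarith)]
  apply if_neg
  rw [D.length_mul_simple_lt_iff (D.W.mul_mem hs hσW) hα, LinearEquiv.mul_apply, h, map_neg,
    sref_self (ne_zero_of_mem (D.Δ_sub hα)), neg_neg]
  linarith

lemma length_conj_lt {α : V} (hα : α ∈ D.Δ) {σ : V ≃ₗ[ℝ] V} (hσW : σ ∈ D.W)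
    (h : D.ht (σ α) < 0) (hne : σ α ≠ -α) :
    D.length (sref V α * σ * sref V α) < D.length (sref V α * σ) := by
  rw [D.length_mul_simple_lt_iff (D.W.mul_mem (D.sref_simple_mem_W hα) hσW) hα,
    LinearEquiv.mul_apply]
  have := D.ht_sref_pos hα (neg_mem (D.apply_mem hσW (D.Δ_sub hα))) (by rw [map_neg]; linarith)
    (fun hc => hne (neg_eq_iff_eq_neg.mp hc))
  rw [map_neg, map_neg] at this
  linarith

lemma descend_of_apply_ne_neg {α : V} (hα : α ∈ D.Δ) {σ : V ≃ₗ[ℝ] V} (hσW : σ ∈ D.W)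
    (hσ : σ * σ = 1) (h : D.ht (σ α) < 0) (hne : σ α ≠ -α) :
    D.descend α σ = sref V α * σ * sref V α := by
  rw [descend, D.shorter_left_of_ht_neg hα hσW hσ h]
  exact if_pos (D.length_conj_lt hα hσW h hne)

/-- Descending an involution along a descent gives a shorter involution whose `L` is one less. -/
lemma descend_spec [FiniteDimensional ℝ V] {α : V} (hα : α ∈ D.Δ) {σ : V ≃ₗ[ℝ] V}
    (hσW : σ ∈ D.W) (hσ : σ * σ = 1) (h : D.ht (σ α) < 0) :
    D.descend α σ ∈ D.W ∧ D.descend α σ * D.descend α σ = 1 ∧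
      D.length (D.descend α σ) < D.length σ ∧ D.Linv (D.descend α σ) + 1 = D.Linv σ := by
  have hs := D.sref_simple_mem_W hα
  have hsσ := D.W.mul_mem hs hσW
  have hlt : D.length (sref V α * σ) < D.length σ := by
    rw [D.length_simple_mul_lt_iff hσW hα, inv_eq_self_of_mul_self hσ]
    exact h
  have hle : D.length σ ≤ D.length (sref V α * σ) + 1 := by
    have := D.length_simple_mul_le hsσ hα
    rwa [← mul_assoc, sref_mul_self, one_mul] at this
  by_cases hne : σ α = -α
  · rw [D.descend_of_apply_eq_neg hα hσW hσ hne]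
    refine ⟨hsσ, ?_, hlt, ?_⟩
    · have hcomm := D.mul_sref hσW α
      rw [hne, sref_neg] at hcomm
      rw [mul_assoc, ← mul_assoc σ, hcomm, mul_assoc, hσ, mul_one, sref_mul_self]
    · have h1 := lamEig_sref_mul (ne_zero_of_mem (D.Δ_sub hα)) hσ hne
      have h2 : D.length σ = D.length (sref V α * σ) + 1 := by omega
      unfold Linv
      rw [← h1, h2]
      push_cast
      ring
  · rw [D.descend_of_apply_ne_neg hα hσW hσ h hne]
    have hlt' := D.length_conj_lt hα hσW h hne
    have hle' : D.length (sref V α * σ) ≤ D.length (sref V α * σ * sref V α) + 1 := by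
      have := D.length_mul_simple_le (D.W.mul_mem hsσ hs) hα
      rwa [mul_assoc _ (sref V α), sref_mul_self, mul_one] at this
    refine ⟨D.W.mul_mem hsσ hs, ?_, hlt'.trans hlt, ?_⟩
    · calc sref V α * σ * sref V α * (sref V α * σ * sref V α)
          = sref V α * σ * (sref V α * sref V α) * σ * sref V α := by group
        _ = sref V α * (σ * σ) * sref V α := by rw [sref_mul_self]; group
        _ = 1 := by rw [hσ, mul_one, sref_mul_self]
    · have h1 := lamEig_conj (sref V α) σ
      rw [sref_inv] at h1
      have h2 : D.length σ = D.length (sref V α * σ * sref V α) + 2 := by omega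
      unfold Linv
      rw [h1, h2]
      push_cast
      ring

lemma descend_injective {α : V} (hα : α ∈ D.Δ) {σ τ : V ≃ₗ[ℝ] V} (hσW : σ ∈ D.W)
    (hσ : σ * σ = 1) (hτW : τ ∈ D.W) (hτ : τ * τ = 1) (hσα : D.ht (σ α) < 0)
    (hτα : D.ht (τ α) < 0) (h : D.descend α σ = D.descend α τ) : σ = τ := by
  have h0 := ne_zero_of_mem (D.Δ_sub hα)
  have mixed : ∀ {σ τ : V ≃ₗ[ℝ] V}, D.ht (σ α) < 0 → D.ht (τ α) < 0 →
      sref V α * σ ≠ sref V α * τ * sref V α := by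
    intro σ τ hσα hτα h
    rw [mul_assoc] at h
    rw [mul_left_cancel h, LinearEquiv.mul_apply, sref_self h0, map_neg, map_neg] at hσα
    linarith
  by_cases h1 : σ α = -α <;> by_cases h2 : τ α = -α
  · rw [D.descend_of_apply_eq_neg hα hσW hσ h1, D.descend_of_apply_eq_neg hα hτW hτ h2] at h
    exact mul_left_cancel h
  · rw [D.descend_of_apply_eq_neg hα hσW hσ h1, D.descend_of_apply_ne_neg hα hτW hτ hτα h2] at h
    exact absurd h (mixed hσα hτα)
  · rw [D.descend_of_apply_ne_neg hα hσW hσ hσα h1, D.descend_of_apply_eq_neg hα hτW hτ h2] at h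
    exact absurd h.symm (mixed hτα hσα)
  · rw [D.descend_of_apply_ne_neg hα hσW hσ hσα h1,
      D.descend_of_apply_ne_neg hα hτW hτ hτα h2] at h
    exact mul_left_cancel (mul_right_cancel h)

lemma eq_one_of_length_eq_zero {w : V ≃ₗ[ℝ] V} (hw : w ∈ D.W) (h : D.length w = 0) : w = 1 := by
  obtain ⟨l, hlen, -, rfl⟩ := D.exists_reduced_word hw
  rw [h, List.length_eq_zero_iff] at hlen
  simp [hlen]

lemma exists_left_descent {w : V ≃ₗ[ℝ] V} (hw : w ∈ D.W) (h : D.length w ≠ 0) :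
    ∃ α ∈ D.Δ, D.length (sref V α * w) < D.length w := by
  obtain ⟨l, hlen, hl, hprod⟩ := D.exists_reduced_word hw
  cases l with
  | nil => exact absurd hlen.symm h
  | cons α l =>
    refine ⟨α, hl α (by simp), ?_⟩
    rw [← hlen, hprod, List.map_cons, List.prod_cons, ← mul_assoc, sref_mul_self, one_mul]
    exact (D.length_le fun γ hγ => hl γ (by simp [hγ])).trans_lt (by simp)

/-- On involutions, `L` is strictly monotone for the Bruhat order. -/
lemma eq_of_ble_of_Linv_le [FiniteDimensional ℝ V] {σ τ : V ≃ₗ[ℝ] V}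
    (hσW : σ ∈ D.W) (hσ : σ * σ = 1) (hτW : τ ∈ D.W) (hτ : τ * τ = 1)
    (hle : D.ble σ τ) (hL : D.Linv τ ≤ D.Linv σ) : σ = τ := by
  induction hn : D.length τ using Nat.strong_induction_on generalizing σ τ with
  | _ n ih =>
    by_cases h0 : D.length τ = 0
    · have := D.ble_length hle
      rw [D.eq_one_of_length_eq_zero hτW h0, D.eq_one_of_length_eq_zero hσW (by omega)]
    · obtain ⟨α, hα, hdesc⟩ := D.exists_left_descent hτW h0
      rw [D.length_simple_mul_lt_iff hτW hα, inv_eq_self_of_mul_self hτ] at hdesc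
      have hmono := D.descend_mono hα hσW hle
      obtain ⟨hW', hinv', hlen', hL'⟩ := D.descend_spec hα hτW hτ hdesc
      rcases lt_or_gt_of_ne (D.ht_ne_zero (D.apply_mem hσW (D.Δ_sub hα))) with h | h
      · obtain ⟨hW'', hinv'', -, hL''⟩ := D.descend_spec hα hσW hσ h
        exact D.descend_injective hα hσW hσ hτW hτ h hdesc
          (ih _ (hn ▸ hlen') hW'' hinv'' hW' hinv' hmono (by linarith) rfl)
      · rw [D.descend_of_ht_pos hα hσW hσ h] at hmono
        have heq := ih _ (hn ▸ hlen') hσW hσ hW' hinv' hmono (by linarith) rfl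
        rw [← heq] at hL'
        linarith

end RSD

/-- Let `σ ≤ τ` be involutions with `L(σ) ≥ L(τ)`.  Then `σ = τ`. -/
theorem statement11 {V : Type} [NormedAddCommGroup V] [InnerProductSpace ℝ V]
    [FiniteDimensional ℝ V]
    (D : RSD V) (σ τ : V ≃ₗ[ℝ] V)
    (hσW : σ ∈ D.W) (hσ : σ * σ = 1) (hτW : τ ∈ D.W) (hτ : τ * τ = 1)
    (hle : D.ble σ τ) (hL : D.Linv τ ≤ D.Linv σ) : σ = τ := by
  exact D.eq_of_ble_of_Linv_le hσW hσ hτW hτ hle hL
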